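/- arXiv:2010.04643 — 11 statements merged into one kernel-verified Lean document; each statement's English description precedes it below -/
import Mathlib

section
/- The bipartite graph G has a matching of size n·m if and only if there exists a set of schedules (σ_1,…,σ_m) for the ESUP instance in which every client is satisfied on at least k days (equivalently, unsatisfied on at most m−k days). -/
/-- The adjacency relation of the bipartite graph `G` for ESUP: a job vertex
`v(i,j)` (modelled as `(i,j) : Fin n × Fin m`) is adjacent exactly to the
completion-slot vertices `u(t,j)` with `1 ≤ t ≤ d i j` (modelled as
`Sum.inl (t, j)`) and to the tardiness vertices `w(i,ℓ)` with `1 ≤ ℓ ≤ m - k`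
(modelled as `Sum.inr (i, ℓ)`). -/
def esupAdj (n m k : ℕ) (d : Fin n → Fin m → ℕ)
    (v : Fin n × Fin m) (u : (ℕ × Fin m) ⊕ (Fin n × ℕ)) : Prop :=
  match u with
  | Sum.inl (t, j) => j = v.2 ∧ 1 ≤ t ∧ t ≤ d v.1 v.2
  | Sum.inr (i, ℓ) => i = v.1 ∧ 1 ≤ ℓ ∧ ℓ ≤ m - k

open Finset in
/-- An injective labelling of a finite set by positive integers can be compressed to an injective
labelling by `0, …, #s - 1` that lies strictly below the original one. -/
theorem exists_injOn_lt_card_of_injOn {α : Type*} (s : Finset α) (t : α → ℕ)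
    (ht : Set.InjOn t s) (hpos : ∀ a ∈ s, 1 ≤ t a) :
    ∃ r : α → ℕ, Set.InjOn r s ∧ ∀ a ∈ s, r a < #s ∧ r a < t a := by
  have hmono : ∀ a ∈ s, ∀ b, t a < t b → #{c ∈ s | t c < t a} < #{c ∈ s | t c < t b} := by
    intro a ha b hab
    refine card_lt_card ((ssubset_iff_of_subset fun c hc => ?_).2 ⟨a, by simp [ha, hab], by simp⟩)
    simp only [mem_filter] at hc ⊢
    exact ⟨hc.1, hc.2.trans hab⟩
  refine ⟨fun a => #{b ∈ s | t b < t a}, fun a ha b hb hab => ht ha hb ?_, fun a ha => ⟨?_, ?_⟩⟩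
  · rcases lt_trichotomy (t a) (t b) with h | h | h
    · exact absurd hab (hmono a ha b h).ne
    · exact h
    · exact absurd hab (hmono b hb a h).ne'
  · exact card_lt_card (filter_ssubset.2 ⟨a, ha, lt_irrefl _⟩)
  · have hle : #{b ∈ s | t b < t a} ≤ #(Ico 1 (t a)) := by
      refine card_le_card_of_injOn t (fun b hb => ?_) (ht.mono fun b hb => ?_)
      · simp only [coe_filter, Set.mem_ofPred_eq] at hb
        simpa using ⟨hpos b hb.1, hb.2⟩
      · exact (mem_filter.1 hb).1
    have := hpos a ha
    rw [Nat.card_Ico] at hle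
    show #{b ∈ s | t b < t a} < t a
    omega

/-- Jobs of unit length occupying distinct slots can be scheduled by a permutation in which none of
them completes later than its slot. -/
theorem exists_perm_succ_le_of_injOn {n : ℕ} (s : Finset (Fin n)) (t : Fin n → ℕ)
    (ht : Set.InjOn t s) (hpos : ∀ i ∈ s, 1 ≤ t i) :
    ∃ σ : Equiv.Perm (Fin n), ∀ i ∈ s, (σ i : ℕ) + 1 ≤ t i := by
  obtain ⟨r, hr, hlt⟩ := exists_injOn_lt_card_of_injOn s t ht hpos
  have hcard : s.card ≤ n := by simpa using s.card_le_univ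
  have himage : s.image r ⊆ Finset.range n := Finset.image_subset_iff.2 fun i hi =>
    Finset.mem_range.2 ((hlt i hi).1.trans_le hcard)
  obtain ⟨σ, hσ⟩ := Finset.exists_equiv_extend_of_card_eq (by simp) himage hr
  refine ⟨(σ.trans (Equiv.subtypeEquivRight fun _ => Finset.mem_range)).trans
    Fin.equivSubtype.symm, fun i hi => ?_⟩
  exact (hσ i hi).trans_lt (hlt i hi).2

/-- A relation on a finite type has a matching saturating the left side, given as a set of edges,
iff it is satisfied by some injective function. -/
theorem exists_matching_iff_exists_injective {α β : Type*} [Fintype α] (R : α → β → Prop) :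
    (∃ M : Finset (α × β), M.card = Fintype.card α ∧ (∀ e ∈ M, R e.1 e.2) ∧
        (∀ e ∈ M, ∀ e' ∈ M, e.1 = e'.1 → e = e') ∧
        (∀ e ∈ M, ∀ e' ∈ M, e.2 = e'.2 → e = e')) ↔
      ∃ f : α → β, Function.Injective f ∧ ∀ a, R a (f a) := by
  classical
  constructor
  · rintro ⟨M, hcard, hR, hfst, hsnd⟩
    have himage : M.image Prod.fst = Finset.univ := by
      rw [← Finset.card_eq_iff_eq_univ, Finset.card_image_of_injOn, hcard]
      exact fun e he e' he' h => hfst e he e' he' h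
    have hex : ∀ a, ∃ b, (a, b) ∈ M := fun a => by
      simpa using himage.ge (Finset.mem_univ a)
    choose f hf using hex
    exact ⟨f, fun a b hab => congrArg Prod.fst (hsnd _ (hf a) _ (hf b) hab), fun a => hR _ (hf a)⟩
  · rintro ⟨f, hf, hR⟩
    refine ⟨Finset.univ.image fun a => (a, f a), ?_, ?_, ?_, ?_⟩
    · exact Finset.card_image_of_injective _ fun a b h => congrArg Prod.fst h
    · simpa using hR
    · simp +contextual
    · simp [hf.eq_iff]

/-- An ESUP matching function yields equitable schedules. -/
theorem exists_equitable_of_injective {n m k : ℕ} (hk : k ≤ m) {d : Fin n → Fin m → ℕ}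
    {f : Fin n × Fin m → (ℕ × Fin m) ⊕ (Fin n × ℕ)} (hf : Function.Injective f)
    (hadj : ∀ v, esupAdj n m k d v (f v)) :
    ∃ σ : Fin m → Equiv.Perm (Fin n),
      ∀ i : Fin n, k ≤ {j : Fin m | (σ j i : ℕ) + 1 ≤ d i j}.ncard := by
  classical
  have hinl : ∀ i j t j', f (i, j) = Sum.inl (t, j') → j' = j ∧ 1 ≤ t ∧ t ≤ d i j := by
    intro i j t j' h
    simpa [esupAdj, h] using hadj (i, j)
  have hinr : ∀ i j i' l, f (i, j) = Sum.inr (i', l) → i' = i ∧ 1 ≤ l ∧ l ≤ m - k := by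
    intro i j i' l h
    simpa [esupAdj, h] using hadj (i, j)
  let slot : Fin n → Fin m → ℕ := fun i j => Sum.elim Prod.fst Prod.snd (f (i, j))
  have hday : ∀ j, ∃ σ : Equiv.Perm (Fin n), ∀ i ∈ Finset.univ.filter
      (fun i => (f (i, j)).isLeft), (σ i : ℕ) + 1 ≤ slot i j := by
    intro j
    refine exists_perm_succ_le_of_injOn _ _ ?_ ?_
    · intro i hi i' hi' h
      simp only [Finset.coe_filter, Finset.mem_univ, true_and, Set.mem_ofPred_eq,
        Sum.isLeft_iff, Prod.exists] at hi hi'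
      obtain ⟨t, a, hta⟩ := hi
      obtain ⟨t', a', hta'⟩ := hi'
      obtain rfl : a = j := (hinl _ _ _ _ hta).1
      obtain rfl : a' = a := (hinl _ _ _ _ hta').1
      obtain rfl : t = t' := by simpa [slot, hta, hta'] using h
      exact congrArg Prod.fst (hf (hta.trans hta'.symm))
    · intro i hi
      simp only [Finset.mem_filter, Finset.mem_univ, true_and, Sum.isLeft_iff, Prod.exists] at hi
      obtain ⟨t, a, hta⟩ := hi
      simpa [slot, hta] using (hinl _ _ _ _ hta).2.1
  choose σ hσ using hday
  refine ⟨σ, fun i => ?_⟩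
  rw [Set.ncard_eq_toFinset_card']
  have hsat : (Finset.univ.filter fun j => (f (i, j)).isLeft) ⊆
      {j : Fin m | (σ j i : ℕ) + 1 ≤ d i j}.toFinset := by
    intro j hj
    have hj' : (f (i, j)).isLeft := by simpa using hj
    obtain ⟨⟨t, a⟩, hta⟩ := Sum.isLeft_iff.1 hj'
    have hle := hσ j i (by simpa using hj')
    have hslot : slot i j = t := by simp [slot, hta]
    rw [Set.mem_toFinset, Set.mem_ofPred_eq]
    exact (hle.trans_eq hslot).trans (hinl _ _ _ _ hta).2.2
  have htardy : (Finset.univ.filter fun j => ¬ (f (i, j)).isLeft).card ≤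
      (Finset.Icc 1 (m - k)).card := by
    refine Finset.card_le_card_of_injOn (slot i) ?_ ?_
    · intro j hj
      simp only [Finset.coe_filter, Finset.mem_univ, true_and, Set.mem_ofPred_eq,
        Sum.not_isLeft, Sum.isRight_iff, Prod.exists] at hj
      obtain ⟨a, l, hal⟩ := hj
      simpa [slot, hal] using (hinr _ _ _ _ hal).2
    · intro j hj j' hj' h
      simp only [Finset.coe_filter, Finset.mem_univ, true_and, Set.mem_ofPred_eq,
        Sum.not_isLeft, Sum.isRight_iff, Prod.exists] at hj hj'
      obtain ⟨a, l, hal⟩ := hj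
      obtain ⟨a', l', hal'⟩ := hj'
      obtain rfl : a = i := (hinr _ _ _ _ hal).1
      obtain rfl : a' = a := (hinr _ _ _ _ hal').1
      obtain rfl : l = l' := by simpa [slot, hal, hal'] using h
      exact congrArg Prod.snd (hf (hal.trans hal'.symm))
  have hsum := Finset.card_filter_add_card_filter_not (s := (Finset.univ : Finset (Fin m)))
    (fun j => ((f (i, j)).isLeft : Prop))
  have hle := Finset.card_le_card hsat
  rw [Nat.card_Icc] at htardy
  rw [Finset.card_univ, Fintype.card_fin] at hsum
  omega

/-- Equitable schedules yield an ESUP matching function. -/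
theorem exists_injective_of_equitable {n m k : ℕ} {d : Fin n → Fin m → ℕ}
    {σ : Fin m → Equiv.Perm (Fin n)}
    (hσ : ∀ i : Fin n, k ≤ {j : Fin m | (σ j i : ℕ) + 1 ≤ d i j}.ncard) :
    ∃ f : Fin n × Fin m → (ℕ × Fin m) ⊕ (Fin n × ℕ),
      Function.Injective f ∧ ∀ v, esupAdj n m k d v (f v) := by
  classical
  have htardy : ∀ i, ∃ r : Fin m → ℕ,
      Set.InjOn r {j | ¬ (σ j i : ℕ) + 1 ≤ d i j} ∧
        ∀ j, ¬ (σ j i : ℕ) + 1 ≤ d i j → r j < m - k := by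
    intro i
    obtain ⟨r, hr, hlt⟩ := exists_injOn_lt_card_of_injOn
      (Finset.univ.filter fun j => ¬ (σ j i : ℕ) + 1 ≤ d i j) (fun j => (j : ℕ) + 1)
      (fun a _ b _ h => Fin.ext (Nat.succ_injective h)) (by simp)
    refine ⟨r, by simpa using hr, fun j hj => ?_⟩
    have hcard := (hlt j (by simpa using hj)).1
    have hsum := Finset.card_filter_add_card_filter_not (s := (Finset.univ : Finset (Fin m)))
      (fun j => (σ j i : ℕ) + 1 ≤ d i j)
    have hsat := hσ i
    rw [Set.ncard_eq_toFinset_card', Set.toFinset_ofPred] at hsat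
    rw [Finset.card_univ, Fintype.card_fin] at hsum
    omega
  choose r hr hlt using htardy
  refine ⟨fun v => if (σ v.2 v.1 : ℕ) + 1 ≤ d v.1 v.2 then Sum.inl ((σ v.2 v.1 : ℕ) + 1, v.2)
    else Sum.inr (v.1, r v.1 v.2 + 1), ?_, ?_⟩
  · rintro ⟨i, j⟩ ⟨i', j'⟩ h
    dsimp only at h
    split_ifs at h with h₁ h₂ h₂
    · obtain ⟨hs, rfl⟩ := Prod.mk.inj (Sum.inl.inj h)
      rw [(σ j).injective (Fin.ext (Nat.succ_injective hs))]
    · obtain ⟨rfl, hs⟩ := Prod.mk.inj (Sum.inr.inj h)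
      rw [hr i h₁ h₂ (Nat.succ_injective hs)]
  · rintro ⟨i, j⟩
    dsimp only
    split_ifs with h
    · exact ⟨rfl, Nat.succ_pos _, h⟩
    · exact ⟨rfl, Nat.succ_pos _, hlt i j h⟩

/-- the bipartite graph `G` has a matching of size `n·m` iff there
exists a set of schedules (one permutation per day) for the ESUP instance in
which every client is satisfied (i.e. the position `σ j i + 1` of its unit job
is at most its deadline `d i j`) on at least `k` of the `m` days. -/
theorem esup_matching_iff_equitable (n m k : ℕ) (hk : k ≤ m)
    (d : Fin n → Fin m → ℕ) :
    (∃ M : Finset ((Fin n × Fin m) × ((ℕ × Fin m) ⊕ (Fin n × ℕ))),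
        M.card = n * m ∧
        (∀ e ∈ M, esupAdj n m k d e.1 e.2) ∧
        (∀ e ∈ M, ∀ e' ∈ M, e.1 = e'.1 → e = e') ∧
        (∀ e ∈ M, ∀ e' ∈ M, e.2 = e'.2 → e = e'))
      ↔
    (∃ σ : Fin m → Equiv.Perm (Fin n),
        ∀ i : Fin n, k ≤ {j : Fin m | (σ j i : ℕ) + 1 ≤ d i j}.ncard) := by
  have hmatch := exists_matching_iff_exists_injective (esupAdj n m k d)
  rw [Fintype.card_prod, Fintype.card_fin, Fintype.card_fin] at hmatch
  rw [hmatch]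
  exact ⟨fun ⟨_, hf, hadj⟩ => exists_equitable_of_injective hk hf hadj,
    fun ⟨_, hσ⟩ => exists_injective_of_equitable hσ⟩
end

section
/- The bipartite graph G has a matching of size n·m if and only if there exists, for each day j, a set S_j of clients together with an injective map φ_j from S_j to {1,…,x(j)} × ℕ_{>0} assigning each i ∈ S_j a machine–slot pair (x,t) with r(i,j) < t ≤ d(i,j), such that every client belongs to S_j for at least k days j. -/
/-- The adjacency relation of the bipartite graph `G` for ESUP with release
dates `r i j` and `x j` parallel machines on day `j`: the job vertex `v(i,j)`
(modelled as `(i,j) : Fin n × Fin m`) is adjacent exactly to the machine–slot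
vertices `u(t,j,x)` with `r i j < t ≤ d i j` and `1 ≤ x ≤ xm j` (modelled as
`Sum.inl (t, j, x)`) and to the tardiness vertices `w(i,ℓ)` with
`1 ≤ ℓ ≤ m - k` (modelled as `Sum.inr (i, ℓ)`). -/
def esupRMAdj (n m k : ℕ) (r d : Fin n → Fin m → ℕ) (xm : Fin m → ℕ)
    (v : Fin n × Fin m) (u : (ℕ × Fin m × ℕ) ⊕ (Fin n × ℕ)) : Prop :=
  match u with
  | Sum.inl (t, j, x) =>
      j = v.2 ∧ r v.1 v.2 < t ∧ t ≤ d v.1 v.2 ∧ 1 ≤ x ∧ x ≤ xm v.2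
  | Sum.inr (i, ℓ) => i = v.1 ∧ 1 ≤ ℓ ∧ ℓ ≤ m - k

theorem Finset.exists_injOn_mem_Icc_of_card_le {α : Type*} (T : Finset α) {c : ℕ}
    (hT : T.card ≤ c) :
    ∃ g : α → ℕ, Set.InjOn g T ∧ ∀ a ∈ T, 1 ≤ g a ∧ g a ≤ c := by
  classical
  refine ⟨fun a => if h : a ∈ T then (T.equivFin ⟨a, h⟩ : ℕ) + 1 else 0, ?_, ?_⟩
  · intro a ha b hb h
    have ha' : a ∈ T := ha
    have hb' : b ∈ T := hb
    simpa [ha', hb', Fin.val_inj] using h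
  · intro a ha
    have := (T.equivFin ⟨a, ha⟩).isLt
    simp only [ha, dite_true]
    omega

theorem le_ncard_iff_card_filter_not_le {m k : ℕ} (hk : k ≤ m) (p : Fin m → Prop)
    [DecidablePred p] :
    k ≤ {j | p j}.ncard ↔ (Finset.univ.filter fun j => ¬ p j).card ≤ m - k := by
  have h := Finset.card_filter_add_card_filter_not (s := (Finset.univ : Finset (Fin m))) p
  have h' : {j | p j}.ncard = (Finset.univ.filter p).card := by
    rw [← Set.ncard_coe_finset]
    simp
  rw [Finset.card_univ, Fintype.card_fin] at h
  omega

/-- the bipartite graph `G` has a matching of size `n·m` iff there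
exist, for each day `j`, a set `S j` of clients and an injective assignment
`φ j` of machine–slot pairs `(x, t)` with `1 ≤ x ≤ xm j` and
`r i j < t ≤ d i j` to the clients `i ∈ S j`, such that every client belongs
to `S j` on at least `k` days. -/
theorem esup_release_machines_matching_iff (n m k : ℕ) (hk : k ≤ m)
    (r d : Fin n → Fin m → ℕ) (hrd : ∀ i j, r i j < d i j)
    (xm : Fin m → ℕ) (hx : ∀ j, 1 ≤ xm j) :
    (∃ M : Finset ((Fin n × Fin m) × ((ℕ × Fin m × ℕ) ⊕ (Fin n × ℕ))),
        M.card = n * m ∧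
        (∀ e ∈ M, esupRMAdj n m k r d xm e.1 e.2) ∧
        (∀ e ∈ M, ∀ e' ∈ M, e.1 = e'.1 → e = e') ∧
        (∀ e ∈ M, ∀ e' ∈ M, e.2 = e'.2 → e = e'))
      ↔
    (∃ S : Fin m → Finset (Fin n), ∃ φ : Fin m → Fin n → ℕ × ℕ,
        (∀ j : Fin m, ∀ i ∈ S j,
            1 ≤ (φ j i).1 ∧ (φ j i).1 ≤ xm j ∧
            r i j < (φ j i).2 ∧ (φ j i).2 ≤ d i j) ∧
        (∀ j : Fin m, ∀ i ∈ S j, ∀ i' ∈ S j, φ j i = φ j i' → i = i') ∧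
        (∀ i : Fin n, k ≤ {j : Fin m | i ∈ S j}.ncard)) := by
  classical
  have hmatch := exists_matching_iff_exists_injective (esupRMAdj n m k r d xm)
  rw [Fintype.card_prod, Fintype.card_fin, Fintype.card_fin] at hmatch
  rw [hmatch]
  simp only [le_ncard_iff_card_filter_not_le hk]
  constructor
  · rintro ⟨f, hf, hadj⟩
    refine ⟨fun j => Finset.univ.filter fun i => (f (i, j)).isLeft,
      fun j i => (f (i, j)).elim (fun u => (u.2.2, u.1)) fun _ => (0, 0), ?_, ?_, ?_⟩
    · intro j i hi
      have h := hadj (i, j)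
      simp only [Finset.mem_filter, Finset.mem_univ, true_and] at hi
      obtain ⟨⟨t, j', x⟩, hu⟩ := Sum.isLeft_iff.mp hi
      simp only [hu, esupRMAdj, Sum.elim_inl] at h ⊢
      tauto
    · intro j i hi i' hi' heq
      have h := hadj (i, j)
      have h' := hadj (i', j)
      simp only [Finset.mem_filter, Finset.mem_univ, true_and] at hi hi'
      obtain ⟨⟨t, j₁, x⟩, hu⟩ := Sum.isLeft_iff.mp hi
      obtain ⟨⟨t', j₂, x'⟩, hu'⟩ := Sum.isLeft_iff.mp hi'
      simp only [hu, hu', esupRMAdj, Sum.elim_inl, Prod.mk.injEq] at h h' heq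
      have : f (i, j) = f (i', j) := by rw [hu, hu', h.1, h'.1, heq.1, heq.2]
      exact congrArg Prod.fst (hf this)
    · intro i
      have htardy : ∀ j, (f (i, j)).isLeft = false →
          ∃ l, f (i, j) = Sum.inr (i, l) ∧ l ∈ Finset.Icc 1 (m - k) := by
        intro j hj
        have h := hadj (i, j)
        obtain ⟨⟨i', l⟩, hu⟩ := Sum.isRight_iff.mp (Sum.isLeft_eq_false.mp hj)
        simp only [hu, esupRMAdj] at h
        exact ⟨l, by rw [hu, h.1], Finset.mem_Icc.mpr h.2⟩
      have hle := Finset.card_le_card_of_injOn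
        (s := Finset.univ.filter fun j => (f (i, j)).isLeft = false)
        (t := Finset.Icc 1 (m - k)) (fun j => (f (i, j)).elim (fun _ => 0) Prod.snd) ?_ ?_
      · simpa using hle
      · intro j hj
        obtain ⟨l, hl, hmem⟩ := htardy j (by simpa using hj)
        simpa [hl] using hmem
      · intro j hj j' hj' heq
        obtain ⟨l, hl, -⟩ := htardy j (by simpa using hj)
        obtain ⟨l', hl', -⟩ := htardy j' (by simpa using hj')
        simp only [hl, hl', Sum.elim_inr] at heq
        have : f (i, j) = f (i, j') := by rw [hl, hl', heq]
        exact congrArg Prod.snd (hf this)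
  · rintro ⟨S, φ, hφ, hinj, hS⟩
    choose g hg hmem using fun i => Finset.exists_injOn_mem_Icc_of_card_le _ (hS i)
    refine ⟨fun v => if v.1 ∈ S v.2 then Sum.inl ((φ v.2 v.1).2, v.2, (φ v.2 v.1).1)
      else Sum.inr (v.1, g v.1 v.2), ?_, ?_⟩
    · rintro ⟨i, j⟩ ⟨i', j'⟩ h
      by_cases hi : i ∈ S j <;> by_cases hi' : i' ∈ S j' <;>
        simp only [hi, hi', if_true, if_false, Sum.inl.injEq, Sum.inr.injEq, Prod.mk.injEq,
          reduceCtorEq] at h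
      · obtain ⟨ht, rfl, hx⟩ := h
        rw [hinj j i hi i' hi' (Prod.ext hx ht)]
      · obtain ⟨rfl, h⟩ := h
        rw [hg i (by simpa using hi) (by simpa using hi') h]
    · rintro ⟨i, j⟩
      by_cases hi : i ∈ S j
      · have := hφ j i hi
        simp only [hi, if_true, esupRMAdj]
        tauto
      · simpa only [hi, if_false, esupRMAdj, true_and] using hmem i j (by simpa using hi)
end

section
/- Let H = (V,F) be a 3-regular graph with V = {v_1,…,v_N} and let ℓ ≤ N. Consider the ESSD instance with client set V ∪ F, m = 2N − ℓ days, deadline d(j) = 3 on every day j, and processing times: on day i ∈ {1,…,N}, the job of client v_i has processing time 3, the job of every client v ≠ v_i has processing time 4, the job of client e ∈ F has processing time 1 if v_i ∈ e and 4 otherwise; on every day j ∈ {N+1,…,2N−ℓ}, the job of every client v ∈ V has processing time 3 and the job of every client e ∈ F has processing time 4. Then H has an independent set of size ℓ if and only if this ESSD instance admits a 1-equitable set of schedules. -/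
open scoped Classical

/-- Processing times of the ESSD instance built from a 3-regular graph `H` on
`N` vertices and a target independent-set size `ℓ`: clients are the vertices
and the edges of `H`, and there are `2N - ℓ` days. On day `j` with `j < N`
(1-indexed day `j+1`, corresponding to vertex `v_{j+1}`), the job of the vertex
client `v` has processing time `3` if `v = v_{j+1}` and `4` otherwise, and the
job of an edge client `e` has processing time `1` if `v_{j+1} ∈ e` and `4`
otherwise. On the remaining days, vertex clients have processing time `3` and
edge clients have processing time `4`. -/
noncomputable def isReductionP (N ℓ : ℕ) (H : SimpleGraph (Fin N))
    (c : Fin N ⊕ ↥H.edgeSet) (j : Fin (2 * N - ℓ)) : ℕ :=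
  match c with
  | Sum.inl v => if (v : ℕ) = (j : ℕ) then 3 else if (j : ℕ) < N then 4 else 3
  | Sum.inr e => if h : (j : ℕ) < N then
      (if (⟨(j : ℕ), h⟩ : Fin N) ∈ (e : Sym2 (Fin N)) then 1 else 4)
    else 4

/-- There is an enumeration of a finite type that lists the elements of a given set first. -/
lemma exists_equiv_fin_initial {α : Type*} [Fintype α] (A : Finset α) :
    ∃ σ : α ≃ Fin (Fintype.card α), ∀ c ∈ A, ∀ c', σ c' ≤ σ c → c' ∈ A := by
  let e := Fintype.equivFin α
  let f : Fin (Fintype.card α) → ℕ := fun i => if e.symm i ∈ A then 0 else 1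
  refine ⟨e.trans (Tuple.sort f).symm, fun c hc c' h => ?_⟩
  have hmono := Tuple.monotone_sort f h
  by_contra hc'
  simp [f, hc, hc'] at hmono

/-- A set of schedules in which every client is satisfied at least once exists iff there is a
choice of client sets, one per day, each of which fits before the deadline, covering all
clients. -/
lemma exists_equitable_iff_exists_cover {ι α : Type*} [Finite ι] [Fintype α]
    (p : α → ι → ℕ) (d : ℕ) :
    (∃ σ : ι → (α ≃ Fin (Fintype.card α)), ∀ c : α,
        1 ≤ {j : ι | ∑ c' ∈ Finset.univ.filter (fun c' => σ j c' ≤ σ j c), p c' j ≤ d}.ncard) ↔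
      ∃ A : ι → Finset α, (∀ j, ∑ c ∈ A j, p c j ≤ d) ∧ ∀ c, ∃ j, c ∈ A j := by
  constructor
  · rintro ⟨σ, hσ⟩
    refine ⟨fun j => Finset.univ.filter fun c =>
      ∑ c' ∈ Finset.univ.filter (fun c' => σ j c' ≤ σ j c), p c' j ≤ d, fun j => ?_, fun c => ?_⟩
    · rcases Finset.eq_empty_or_nonempty (Finset.univ.filter fun c =>
        ∑ c' ∈ Finset.univ.filter (fun c' => σ j c' ≤ σ j c), p c' j ≤ d) with h | h
      · simp [h]
      · obtain ⟨m, hm, hmax⟩ := Finset.exists_max_image _ (σ j) h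
        refine le_trans (Finset.sum_le_sum_of_subset fun c hc => ?_) (Finset.mem_filter.1 hm).2
        exact Finset.mem_filter.2 ⟨Finset.mem_univ _, hmax c hc⟩
    · obtain ⟨j, hj⟩ := (Set.ncard_pos (Set.toFinite _)).1 (hσ c)
      exact ⟨j, Finset.mem_filter.2 ⟨Finset.mem_univ _, hj⟩⟩
  · rintro ⟨A, hA, hcov⟩
    choose σ hσ using fun j => exists_equiv_fin_initial (A j)
    refine ⟨σ, fun c => (Set.ncard_pos (Set.toFinite _)).2 ?_⟩
    obtain ⟨j, hj⟩ := hcov c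
    refine ⟨j, le_trans (Finset.sum_le_sum_of_subset fun c' hc' => ?_) (hA j)⟩
    exact hσ j c hj c' (Finset.mem_filter.1 hc').2

section Reduction

variable {N ℓ : ℕ} {H : SimpleGraph (Fin N)}

lemma three_le_isReductionP_inl (v : Fin N) (j : Fin (2 * N - ℓ)) :
    3 ≤ isReductionP N ℓ H (Sum.inl v) j := by
  unfold isReductionP
  dsimp only
  split_ifs <;> omega

lemma one_le_isReductionP_inr (e : H.edgeSet) (j : Fin (2 * N - ℓ)) :
    1 ≤ isReductionP N ℓ H (Sum.inr e) j := by
  unfold isReductionP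
  dsimp only
  split_ifs <;> omega

lemma exists_mem_of_isReductionP_inr_le {e : H.edgeSet} {j : Fin (2 * N - ℓ)}
    (h : isReductionP N ℓ H (Sum.inr e) j ≤ 3) :
    ∃ v : Fin N, (v : ℕ) = j ∧ v ∈ (e : Sym2 (Fin N)) := by
  unfold isReductionP at h
  dsimp only at h
  split_ifs at h with h1 h2
  · exact ⟨_, rfl, h2⟩
  all_goals omega

lemma isReductionP_add_le {A : Finset (Fin N ⊕ H.edgeSet)} {j : Fin (2 * N - ℓ)}
    (hA : ∑ c ∈ A, isReductionP N ℓ H c j ≤ 3) {c c' : Fin N ⊕ H.edgeSet}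
    (hc : c ∈ A) (hc' : c' ∈ A) (hne : c ≠ c') :
    isReductionP N ℓ H c j + isReductionP N ℓ H c' j ≤ 3 := by
  rw [← Finset.sum_pair (f := fun c => isReductionP N ℓ H c j) hne]
  refine le_trans (Finset.sum_le_sum_of_subset ?_) hA
  simp [Finset.insert_subset_iff, hc, hc']

/-- If the clients can be covered by sets that fit on the days, then `H` has an independent
set of size `ℓ`. -/
lemma exists_independent_of_cover (hℓ : ℓ ≤ N)
    {A : Fin (2 * N - ℓ) → Finset (Fin N ⊕ H.edgeSet)}
    (hA : ∀ j, ∑ c ∈ A j, isReductionP N ℓ H c j ≤ 3) (hcov : ∀ c, ∃ j, c ∈ A j) :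
    ∃ S : Finset (Fin N), S.card = ℓ ∧ ∀ u ∈ S, ∀ v ∈ S, ¬ H.Adj u v := by
  choose f hf using fun v : Fin N => hcov (Sum.inl v)
  have hinj : Function.Injective f := fun u v huv => by
    by_contra hne
    have h := isReductionP_add_le (hA (f u)) (hf u) (huv ▸ hf v) (by simpa using hne)
    have := three_le_isReductionP_inl (H := H) u (f u)
    have := three_le_isReductionP_inl (H := H) v (f u)
    omega
  let D : Finset (Fin (2 * N - ℓ)) := Finset.univ.filter fun j => ∃ e, Sum.inr e ∈ A j
  have hdisj : Disjoint D (Finset.univ.image f) := by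
    rw [Finset.disjoint_left]
    intro j hj hj'
    obtain ⟨e, he⟩ := (Finset.mem_filter.1 hj).2
    obtain ⟨v, -, rfl⟩ := Finset.mem_image.1 hj'
    have h := isReductionP_add_le (hA (f v)) (hf v) he (by simp)
    have := three_le_isReductionP_inl (H := H) v (f v)
    have := one_le_isReductionP_inr e (f v)
    omega
  have hD : D.card + N ≤ 2 * N - ℓ := by
    have h := Finset.card_le_univ (D ∪ Finset.univ.image f)
    rwa [Finset.card_union_of_disjoint hdisj, Finset.card_image_of_injective _ hinj,
      Finset.card_univ, Fintype.card_fin, Fintype.card_fin] at h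
  let T : Finset (Fin N) := Finset.univ.filter fun v => ∃ j ∈ D, (j : ℕ) = v
  have hT : T.card ≤ D.card := by
    rw [← Finset.card_map Fin.valEmbedding, ← Finset.card_map (s := D) Fin.valEmbedding]
    refine Finset.card_le_card fun n hn => ?_
    obtain ⟨v, hv, rfl⟩ := Finset.mem_map.1 hn
    obtain ⟨j, hj, hjv⟩ := (Finset.mem_filter.1 hv).2
    exact Finset.mem_map.2 ⟨j, hj, hjv⟩
  have hTc : ℓ ≤ Tᶜ.card := by
    rw [Finset.card_compl, Fintype.card_fin]
    omega
  obtain ⟨S, hS, hcard⟩ := Finset.exists_subset_card_eq hTc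
  refine ⟨S, hcard, fun u hu v hv huv => ?_⟩
  obtain ⟨j, hj⟩ := hcov (Sum.inr ⟨s(u, v), huv⟩)
  obtain ⟨w, hwj, hw⟩ := exists_mem_of_isReductionP_inr_le
    ((Finset.single_le_sum (f := fun c => isReductionP N ℓ H c j)
      (fun _ _ => Nat.zero_le _) hj).trans (hA j))
  have hwT : w ∈ T := Finset.mem_filter.2
    ⟨Finset.mem_univ _, j, Finset.mem_filter.2 ⟨Finset.mem_univ _, _, hj⟩, hwj.symm⟩
  rcases Sym2.mem_iff.1 hw with rfl | rfl
  · exact Finset.mem_compl.1 (hS hu) hwT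
  · exact Finset.mem_compl.1 (hS hv) hwT

/-- If `H` is 3-regular with an independent set of size `ℓ`, then the clients can be covered by
sets that fit on the days. -/
lemma exists_cover_of_independent [DecidableRel H.Adj] (hreg : ∀ v : Fin N, H.degree v = 3)
    {S : Finset (Fin N)} (hcard : S.card = ℓ) (hS : ∀ u ∈ S, ∀ v ∈ S, ¬ H.Adj u v) :
    ∃ A : Fin (2 * N - ℓ) → Finset (Fin N ⊕ H.edgeSet),
      (∀ j, ∑ c ∈ A j, isReductionP N ℓ H c j ≤ 3) ∧ ∀ c, ∃ j, c ∈ A j := by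
  have hle : ℓ ≤ N := by simpa [hcard] using Finset.card_le_univ S
  have hc : Sᶜ.card = N - ℓ := by rw [Finset.card_compl, Fintype.card_fin, hcard]
  let g := Finset.equivFinOfCardEq hc
  let E (v : Fin N) : Finset H.edgeSet := Finset.univ.filter fun e => v ∈ (e : Sym2 (Fin N))
  have hE (v : Fin N) : (E v).card = 3 := by
    rw [← hreg v, ← H.card_incidenceFinset_eq_degree,
      ← Finset.card_map (Function.Embedding.subtype _)]
    congr 1
    ext e
    simp [E, SimpleGraph.incidenceSet, and_comm]
  refine ⟨fun j => if h : (j : ℕ) < N then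
      if (⟨j, h⟩ : Fin N) ∈ S then {Sum.inl ⟨j, h⟩} else (E ⟨j, h⟩).map Function.Embedding.inr
    else {Sum.inl (g.symm ⟨j - N, by omega⟩).1}, fun j => ?_, ?_⟩
  · dsimp only
    split_ifs with h hj
    · simp [isReductionP]
    · rw [Finset.sum_map, ← hE ⟨j, h⟩, Finset.card_eq_sum_ones]
      refine Finset.sum_le_sum fun e he => ?_
      simp [isReductionP, h, (Finset.mem_filter.1 he).2]
    · simp [isReductionP, h]
  · rintro (v | ⟨e, he⟩)
    · by_cases hv : v ∈ S
      · exact ⟨⟨v, by omega⟩, by simp [hv]⟩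
      · have := (g ⟨v, Finset.mem_compl.2 hv⟩).2
        exact ⟨⟨N + g ⟨v, Finset.mem_compl.2 hv⟩, by omega⟩, by simp⟩
    · obtain ⟨v, hve, hv⟩ : ∃ v ∈ e, v ∉ S := by
        induction e using Sym2.ind with
        | _ a b =>
          by_contra! h
          exact hS a (h a (by simp)) b (h b (by simp)) he
      exact ⟨⟨v, by omega⟩, by simp [hv, E, hve]⟩

end Reduction

/-- a 3-regular graph `H` on `N` vertices has an independent set
of size `ℓ ≤ N` iff the ESSD instance above (with common deadline `3` on every
day) admits a 1-equitable set of schedules. A schedule for a day is a bijection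
of the clients with positions `Fin (#clients)`; a client `c` is satisfied on
day `j` if the total processing time of the jobs in positions up to `c`'s
position is at most `3`. -/
theorem independentSet_iff_essd_equitable (N ℓ : ℕ) (hℓ : ℓ ≤ N)
    (H : SimpleGraph (Fin N)) [DecidableRel H.Adj]
    (hreg : ∀ v : Fin N, H.degree v = 3) :
    (∃ S : Finset (Fin N), S.card = ℓ ∧ ∀ u ∈ S, ∀ v ∈ S, ¬ H.Adj u v)
      ↔
    (∃ σ : Fin (2 * N - ℓ) →
        ((Fin N ⊕ ↥H.edgeSet) ≃ Fin (Fintype.card (Fin N ⊕ ↥H.edgeSet))),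
        ∀ c : Fin N ⊕ ↥H.edgeSet,
          1 ≤ {j : Fin (2 * N - ℓ) |
            ∑ c' ∈ Finset.univ.filter (fun c' => σ j c' ≤ σ j c),
              isReductionP N ℓ H c' j ≤ 3}.ncard) := by
  rw [exists_equitable_iff_exists_cover]
  constructor
  · rintro ⟨S, hcard, hS⟩
    exact exists_cover_of_independent hreg hcard hS
  · rintro ⟨A, hA, hcov⟩
    exact exists_independent_of_cover hℓ hA hcov
end

section
/- Let s_1,…,s_n ∈ ℕ_{>0} be item sizes, let b ∈ ℕ_{>0} be a number of bins and B ∈ ℕ a bin capacity. Consider the ESSD* instance with n clients where client i has processing time p(i) = s_i, with m = b days, common deadline d = B, and equity parameter k = 1. Then there exists a map f : {1,…,n} → {1,…,b} with Σ_{i : f(i) = j} s_i ≤ B for every bin j if and only if this ESSD* instance admits a 1-equitable set of schedules. -/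
/-- Any set of clients can be scheduled as an initial segment of some permutation. -/
theorem exists_perm_initial_segment {n : ℕ} (P : Fin n → Prop) :
    ∃ σ : Equiv.Perm (Fin n), ∀ x y, P x → σ y ≤ σ x → P y := by
  classical
  let g : Fin n → ℕ := fun x => if P x then 0 else 1
  refine ⟨(Tuple.sort g).symm, fun x y hx hyx => ?_⟩
  have h := Tuple.monotone_sort g hyx
  simp only [Function.comp_apply, Equiv.apply_symm_apply, g, hx, if_true] at h
  by_contra hy
  simp [hy] at h

/-- given item sizes `s i > 0`, `b ≥ 1` bins of capacity `B`,
the items can be packed into the bins iff the ESSD* instance with `n` clients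
of processing times `p i = s i`, `m = b` days, common deadline `d = B` and
equity parameter `k = 1` admits a 1-equitable set of schedules. -/
theorem binPacking_iff_essdStar_equitable (n b B : ℕ) (hb : 1 ≤ b)
    (s : Fin n → ℕ) (hs : ∀ i, 0 < s i) :
    (∃ f : Fin n → Fin b,
        ∀ j : Fin b, ∑ i ∈ Finset.univ.filter (fun i => f i = j), s i ≤ B)
      ↔
    (∃ σ : Fin b → Equiv.Perm (Fin n),
        ∀ i : Fin n, 1 ≤ {j : Fin b |
          ∑ i' ∈ Finset.univ.filter (fun i' => σ j i' ≤ σ j i), s i' ≤ B}.ncard) := by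
  constructor
  · rintro ⟨f, hf⟩
    choose σ hσ using fun j : Fin b => exists_perm_initial_segment (fun i => f i = j)
    refine ⟨σ, fun i => ?_⟩
    rw [Nat.one_le_iff_ne_zero, ← Nat.pos_iff_ne_zero, Set.ncard_pos (Set.toFinite _)]
    refine ⟨f i, (Finset.sum_le_sum_of_subset fun i' hi' => ?_).trans (hf (f i))⟩
    simp only [Finset.mem_filter, Finset.mem_univ, true_and] at hi' ⊢
    exact hσ (f i) i i' rfl hi'
  · rintro ⟨σ, h⟩
    have hne (i : Fin n) : ∃ j : Fin b,
        ∑ i' ∈ Finset.univ.filter (fun i' => σ j i' ≤ σ j i), s i' ≤ B :=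
      Set.nonempty_of_ncard_ne_zero (Nat.one_le_iff_ne_zero.mp (h i))
    choose f hf using hne
    refine ⟨f, fun j => ?_⟩
    rcases (Finset.univ.filter (fun i => f i = j)).eq_empty_or_nonempty with he | he
    · simp [he]
    · obtain ⟨i, hi, hmax⟩ := Finset.exists_max_image _ (σ j) he
      obtain rfl : f i = j := (Finset.mem_filter.mp hi).2
      refine (Finset.sum_le_sum_of_subset fun i' hi' => ?_).trans (hf i)
      exact Finset.mem_filter.mpr ⟨Finset.mem_univ _, hmax i' hi'⟩
end

section
/- If an ESSD* instance admits a k-equitable set of schedules, then k · Σ_{i=1}^{n} p(i) ≤ m · d. -/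
/-- On a single day, the total processing time of the clients satisfied under the schedule `σ`
is at most the deadline. -/
theorem sum_satisfied_le_deadline {ι α : Type*} [Fintype ι] [LinearOrder α]
    (p : ι → ℕ) (d : ℕ) (σ : ι → α) :
    ∑ i with ∑ i' with σ i' ≤ σ i, p i' ≤ d, p i ≤ d := by
  set S := Finset.univ.filter fun i => ∑ i' with σ i' ≤ σ i, p i' ≤ d
  rcases S.eq_empty_or_nonempty with h | h
  · simp [h]
  · obtain ⟨a, ha, hmax⟩ := S.exists_max_image σ h
    calc ∑ i ∈ S, p i ≤ ∑ i' with σ i' ≤ σ a, p i' :=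
          Finset.sum_le_sum_of_subset fun i hi => by simpa using hmax i hi
      _ ≤ d := (Finset.mem_filter.mp ha).2

/-- if an ESSD* instance (n clients with processing times
`p i > 0`, `m` days, common deadline `d`, equity parameter `k ≤ m`) admits a
k-equitable set of schedules, then `k · Σ_i p i ≤ m · d`. -/
theorem essdStar_equitable_capacity_bound (n m k d : ℕ) (hk : k ≤ m)
    (p : Fin n → ℕ) (hp : ∀ i, 0 < p i)
    (σ : Fin m → Equiv.Perm (Fin n))
    (heq : ∀ i : Fin n, k ≤ {j : Fin m |
      ∑ i' ∈ Finset.univ.filter (fun i' => σ j i' ≤ σ j i), p i' ≤ d}.ncard) :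
    k * ∑ i : Fin n, p i ≤ m * d := by
  classical
  let sat (j : Fin m) (i : Fin n) : Prop :=
    ∑ i' ∈ Finset.univ.filter (fun i' => σ j i' ≤ σ j i), p i' ≤ d
  have hcard (i : Fin n) : k ≤ (Finset.univ.filter fun j => sat j i).card := by
    rw [← Set.ncard_coe_finset]
    simpa [sat] using heq i
  calc k * ∑ i, p i = ∑ i, k * p i := Finset.mul_sum ..
    _ ≤ ∑ i, (Finset.univ.filter fun j => sat j i).card * p i :=
        Finset.sum_le_sum fun i _ => Nat.mul_le_mul_right _ (hcard i)
    _ = ∑ i, ∑ j, if sat j i then p i else 0 := by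
        refine Finset.sum_congr rfl fun i _ => ?_
        rw [← Finset.sum_filter, Finset.sum_const, smul_eq_mul]
    _ = ∑ j, ∑ i with sat j i, p i := by
        rw [Finset.sum_comm]
        simp only [Finset.sum_filter]
    _ ≤ ∑ _j : Fin m, d := Finset.sum_le_sum fun j _ => by
        convert sum_satisfied_le_deadline p d (σ j)
    _ = m * d := by simp
end

section
/- If an ESSD* instance with 2k > m admits a k-equitable set of schedules, then p(i_1) + p(i_2) ≤ d for every two distinct clients i_1 ≠ i_2. -/
/-- if an ESSD* instance (n clients with processing times
`p i > 0`, `m` days, common deadline `d`, equity parameter `k ≤ m`) with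
`2k > m` admits a k-equitable set of schedules, then `p i₁ + p i₂ ≤ d` for
every two distinct clients `i₁ ≠ i₂`. -/
theorem essdStar_no_two_heavy (n m k d : ℕ) (hk : k ≤ m) (hkm : m < 2 * k)
    (p : Fin n → ℕ) (hp : ∀ i, 0 < p i)
    (σ : Fin m → Equiv.Perm (Fin n))
    (heq : ∀ i : Fin n, k ≤ {j : Fin m |
      ∑ i' ∈ Finset.univ.filter (fun i' => σ j i' ≤ σ j i), p i' ≤ d}.ncard) :
    ∀ i₁ i₂ : Fin n, i₁ ≠ i₂ → p i₁ + p i₂ ≤ d := by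
  intro i₁ i₂ hne
  have hpair : ∀ j a b, a ≠ b → σ j a ≤ σ j b →
      ∑ i' ∈ Finset.univ.filter (fun i' => σ j i' ≤ σ j b), p i' ≤ d → p a + p b ≤ d := by
    intro j a b hab hle hd
    rw [← Finset.sum_pair hab]
    refine (Finset.sum_le_sum_of_subset ?_).trans hd
    intro x hx
    rcases Finset.mem_insert.mp hx with rfl | hx
    · simpa using hle
    · simp [Finset.mem_singleton.mp hx]
  by_contra hlt
  have hdisj : Disjoint
      {j : Fin m | ∑ i' ∈ Finset.univ.filter (fun i' => σ j i' ≤ σ j i₁), p i' ≤ d}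
      {j : Fin m | ∑ i' ∈ Finset.univ.filter (fun i' => σ j i' ≤ σ j i₂), p i' ≤ d} := by
    refine Set.disjoint_left.mpr fun j h₁ h₂ => hlt ?_
    rcases le_total (σ j i₁) (σ j i₂) with hle | hle
    · exact hpair j i₁ i₂ hne hle h₂
    · exact (Nat.add_comm _ _).trans_le (hpair j i₂ i₁ hne.symm hle h₁)
  have hunion := Set.ncard_union_eq hdisj (Set.toFinite _) (Set.toFinite _)
  have hcard := Set.ncard_le_card
    ({j : Fin m | ∑ i' ∈ Finset.univ.filter (fun i' => σ j i' ≤ σ j i₁), p i' ≤ d} ∪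
      {j : Fin m | ∑ i' ∈ Finset.univ.filter (fun i' => σ j i' ≤ σ j i₂), p i' ≤ d})
  rw [Nat.card_fin] at hcard
  have h₁ := heq i₁
  have h₂ := heq i₂
  omega
end

section
/- If an ESSD* instance with 2k > m admits a k-equitable set of schedules, then at most three clients i satisfy 3 · p(i) > d. -/
/-- On a single day at most two large clients are satisfied. -/
lemma card_large_satisfied_le_two {n d : ℕ} (p : Fin n → ℕ) (τ : Equiv.Perm (Fin n))
    (S : Finset (Fin n)) (hlarge : ∀ i ∈ S, d < 3 * p i)
    (hsat : ∀ i ∈ S, ∑ i' ∈ Finset.univ.filter (fun i' => τ i' ≤ τ i), p i' ≤ d) :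
    S.card ≤ 2 := by
  by_contra! hcard
  obtain ⟨i, hi, hmax⟩ := S.exists_max_image τ (Finset.card_pos.mp (by omega))
  have hsub : S ⊆ Finset.univ.filter (fun i' => τ i' ≤ τ i) := fun x hx => by
    simpa using hmax x hx
  have hsum : ∑ x ∈ S, p x ≤ d :=
    (Finset.sum_le_sum_of_subset hsub).trans (hsat i hi)
  have hlow : S.card * (d + 1) ≤ 3 * ∑ x ∈ S, p x := by
    rw [Finset.mul_sum, ← smul_eq_mul]
    exact Finset.card_nsmul_le_sum _ _ _ hlarge
  nlinarith


/-- if an ESSD* instance (n clients with processing times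
`p i > 0`, `m` days, common deadline `d`, equity parameter `k ≤ m`) with
`2k > m` admits a k-equitable set of schedules, then at most three clients `i`
are large, i.e. satisfy `3 · p i > d`. -/
theorem essdStar_at_most_three_large (n m k d : ℕ) (hk : k ≤ m) (hkm : m < 2 * k)
    (p : Fin n → ℕ) (hp : ∀ i, 0 < p i)
    (σ : Fin m → Equiv.Perm (Fin n))
    (heq : ∀ i : Fin n, k ≤ {j : Fin m |
      ∑ i' ∈ Finset.univ.filter (fun i' => σ j i' ≤ σ j i), p i' ≤ d}.ncard) :
    {i : Fin n | d < 3 * p i}.ncard ≤ 3 := by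
  classical
  rw [Set.ncard_eq_toFinset_card']
  set L := {i : Fin n | d < 3 * p i}.toFinset with hL
  let R : Fin n → Fin m → Prop := fun i j =>
    ∑ i' ∈ Finset.univ.filter (fun i' => σ j i' ≤ σ j i), p i' ≤ d
  have hcount : L.card * k ≤ (Finset.univ : Finset (Fin m)).card * 2 := by
    refine Finset.card_mul_le_card_mul R (fun i _ => ?_) (fun j _ => ?_)
    · have h := heq i
      rw [Set.ncard_eq_toFinset_card'] at h
      simpa [Finset.bipartiteAbove, R] using h
    · refine card_large_satisfied_le_two (d := d) p (σ j) _ (fun i hi => ?_) (fun i hi => ?_)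
      · simpa [hL] using (Finset.mem_filter.mp hi).1
      · exact (Finset.mem_filter.mp hi).2
  rw [Finset.card_univ, Fintype.card_fin] at hcount
  by_contra! hcard
  nlinarith
end

section
/- If an ESSD* instance with k ≥ 1 admits a k-equitable set of schedules, then k · |{i : 2 · p(i) > d}| ≤ m; in particular there are at most ⌊m/k⌋ clients whose processing time exceeds d/2. -/
/-- On a single day, at most one satisfied client has processing time exceeding `d / 2`. -/
theorem eq_of_satisfied_of_heavy {n d : ℕ} {p : Fin n → ℕ} (τ : Equiv.Perm (Fin n))
    {a b : Fin n} (ha : d < 2 * p a) (hb : d < 2 * p b)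
    (hsa : ∑ i ∈ Finset.univ.filter (fun i => τ i ≤ τ a), p i ≤ d)
    (hsb : ∑ i ∈ Finset.univ.filter (fun i => τ i ≤ τ b), p i ≤ d) : a = b := by
  wlog hab : τ a ≤ τ b generalizing a b
  · exact (this hb ha hsb hsa (le_of_not_ge hab)).symm
  by_contra hne
  have hsub : ({a, b} : Finset (Fin n)) ⊆ Finset.univ.filter (fun i => τ i ≤ τ b) := by
    simp [Finset.insert_subset_iff, hab]
  have hle := Finset.sum_le_sum_of_subset (f := p) hsub
  rw [Finset.sum_pair hne] at hle
  omega

/-- if an ESSD* instance (n clients with processing times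
`p i > 0`, `m` days, common deadline `d`, equity parameter `1 ≤ k ≤ m`) admits
a k-equitable set of schedules, then `k · |{i : 2·p i > d}| ≤ m`; in
particular, at most `⌊m/k⌋` clients have processing time exceeding `d/2`. -/
theorem essdStar_few_heavy_clients (n m k d : ℕ) (hk : k ≤ m) (hk1 : 1 ≤ k)
    (p : Fin n → ℕ) (hp : ∀ i, 0 < p i)
    (σ : Fin m → Equiv.Perm (Fin n))
    (heq : ∀ i : Fin n, k ≤ {j : Fin m |
      ∑ i' ∈ Finset.univ.filter (fun i' => σ j i' ≤ σ j i), p i' ≤ d}.ncard) :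
    k * {i : Fin n | d < 2 * p i}.ncard ≤ m ∧
    {i : Fin n | d < 2 * p i}.ncard ≤ m / k := by
  classical
  have hmul : k * {i : Fin n | d < 2 * p i}.ncard ≤ m := by
    let H : Finset (Fin n) := Finset.univ.filter fun i => d < 2 * p i
    let S : Fin n → Finset (Fin m) := fun i => Finset.univ.filter fun j =>
      ∑ i' ∈ Finset.univ.filter (fun i' => σ j i' ≤ σ j i), p i' ≤ d
    have hS : ∀ i ∈ H, k ≤ (S i).card := fun i _ => by
      simpa [S, Set.ncard_eq_toFinset_card'] using heq i
    have hdisj : (H : Set (Fin n)).PairwiseDisjoint S := by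
      intro a ha b hb hab
      refine Finset.disjoint_left.mpr fun j hja hjb => hab ?_
      simp only [H, S, Finset.coe_filter, Finset.mem_filter, Finset.mem_univ, true_and,
        Set.mem_ofPred_eq] at ha hb hja hjb
      exact eq_of_satisfied_of_heavy (σ j) ha hb hja hjb
    have hH : {i : Fin n | d < 2 * p i}.ncard = H.card := by
      simp [H, Set.ncard_eq_toFinset_card']
    calc k * {i : Fin n | d < 2 * p i}.ncard = H.card • k := by
          rw [hH, smul_eq_mul, mul_comm]
      _ ≤ ∑ i ∈ H, (S i).card := Finset.card_nsmul_le_sum _ _ _ hS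
      _ = (H.biUnion S).card := (Finset.card_biUnion hdisj).symm
      _ ≤ m := by simpa using Finset.card_le_univ (H.biUnion S)
  exact ⟨hmul, (Nat.le_div_iff_mul_le hk1).mpr (by rwa [mul_comm])⟩
end

section
/- Let H = (U,F) be a graph with U = {v_1,…,v_N}, and let h ≤ N with C(h,2) ≤ |F|, where C(h,2) = h(h−1)/2. Consider the ESPC instance with client set U ∪ F, m = 2 days, unit processing times, and k = 1, where: on day 1 the precedence DAG has the arcs (v_ℓ, v_{ℓ+1}) for all ℓ ∈ {1,…,N−1} and the arcs (v_N, e) for all e ∈ F, and the deadline is d(1) = N + |F| − C(h,2); on day 2 the precedence DAG has the arcs (v, e) for every v ∈ U and e ∈ F with v ∈ e, and the deadline is d(2) = h + C(h,2). Then H contains a clique of size h (a set of h pairwise adjacent vertices) if and only if this ESPC instance admits a 1-equitable set of feasible schedules. -/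
/-- A finite type can be enumerated in an order along which a given rank function increases. -/
theorem exists_equiv_fin_lt_of_rank_lt {α : Type*} [Fintype α] (f : α → ℕ) :
    ∃ σ : α ≃ Fin (Fintype.card α), ∀ a b, f a < f b → σ a < σ b := by
  let e := Fintype.equivFin α
  refine ⟨e.trans (Tuple.sort (f ∘ e.symm)).symm, fun a b hab => ?_⟩
  by_contra! hle
  have hmono := Tuple.monotone_sort (f ∘ e.symm) hle
  simp only [Function.comp_apply, Equiv.trans_apply, Equiv.apply_symm_apply,
    Equiv.symm_apply_apply] at hmono
  omega

/-- In an enumeration compatible with a rank function, the position of `a` is bounded by the number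
of elements of rank at most that of `a`. -/
theorem position_lt_of_rank_le {α : Type*} [Fintype α] {n : ℕ} (f : α → ℕ) (σ : α ≃ Fin n)
    (hσ : ∀ a b, f a < f b → σ a < σ b) (s : Finset α) (a : α)
    (hs : ∀ c, f c ≤ f a → c ∈ s) : (σ a : ℕ) + 1 ≤ s.card := by
  have hsub : (Finset.Iic (σ a)).map σ.symm.toEmbedding ⊆ s := by
    intro c hc
    obtain ⟨i, hi, rfl⟩ := Finset.mem_map.1 hc
    refine hs _ (not_lt.1 fun hlt => ?_)
    have := hσ _ _ hlt
    simp only [Equiv.coe_toEmbedding, Equiv.apply_symm_apply] at this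
    exact absurd (Finset.mem_Iic.1 hi) (not_le.2 this)
  simpa using Finset.card_le_card hsub

/-- At most `d` clients meet the deadline `d`. -/
theorem card_le_of_position_lt {α : Type*} {n : ℕ} (σ : α ≃ Fin n) (s : Finset α) (d : ℕ)
    (hs : ∀ c ∈ s, (σ c : ℕ) + 1 ≤ d) : s.card ≤ d := by
  have := Finset.card_le_card_of_injOn (t := Finset.range d) (fun c => (σ c : ℕ))
    (fun c hc => Finset.mem_coe.2 (Finset.mem_range.2 (hs c hc)))
    (fun a _ b _ hab => σ.injective (Fin.ext hab))
  simpa using this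

/-- A clique on `S` spans exactly `(#S).choose 2` edges. -/
theorem card_edges_inside_clique {V : Type*} [DecidableEq V] (H : SimpleGraph V)
    [Fintype ↥H.edgeSet] (S : Finset V) (hS : ∀ u ∈ S, ∀ v ∈ S, u ≠ v → H.Adj u v)
    [DecidablePred fun e : ↥H.edgeSet => ∀ v ∈ (e : Sym2 V), v ∈ S] :
    (Finset.univ.filter fun e : ↥H.edgeSet => ∀ v ∈ (e : Sym2 V), v ∈ S).card
      = S.card.choose 2 := by
  rw [← Sym2.card_image_offDiag, ← Finset.card_map (Function.Embedding.subtype _)]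
  congr 1
  ext e
  induction e using Sym2.ind with
  | h a b =>
    simp only [Finset.mem_map, Finset.mem_filter, Finset.mem_univ, true_and,
      Function.Embedding.subtype_apply, Finset.mem_image, Finset.mem_offDiag, Prod.exists]
    constructor
    · rintro ⟨⟨e, he⟩, hin, rfl⟩
      exact ⟨a, b, ⟨hin a (by simp), hin b (by simp), H.ne_of_adj he⟩, rfl⟩
    · rintro ⟨x, y, ⟨hx, hy, hne⟩, hxy⟩
      refine ⟨⟨s(x, y), hS x hx y hy hne⟩, ?_, hxy⟩
      intro v hv
      rcases Sym2.mem_iff.1 hv with rfl | rfl <;> assumption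

theorem edges_subset_image_offDiag {V : Type*} [DecidableEq V] (H : SimpleGraph V)
    (S : Finset V) (E : Finset ↥H.edgeSet) (hE : ∀ e ∈ E, ∀ v ∈ (e : Sym2 V), v ∈ S) :
    E.map (Function.Embedding.subtype _) ⊆ S.offDiag.image Sym2.mk.uncurry := by
  intro e he
  obtain ⟨⟨e, hadj⟩, hmem, rfl⟩ := Finset.mem_map.1 he
  induction e using Sym2.ind with
  | h a b =>
    exact Finset.mem_image.2 ⟨(a, b), Finset.mem_offDiag.2
      ⟨hE _ hmem a (by simp), hE _ hmem b (by simp), H.ne_of_adj hadj⟩, rfl⟩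

/-- A vertex set containing the endpoints of at least `(#S).choose 2` edges is a clique. -/
theorem adj_of_choose_two_le_card_edges {V : Type*} [DecidableEq V] (H : SimpleGraph V)
    (S : Finset V) (E : Finset ↥H.edgeSet)
    (hE : ∀ e ∈ E, ∀ v ∈ (e : Sym2 V), v ∈ S) (hcard : S.card.choose 2 ≤ E.card) :
    ∀ u ∈ S, ∀ v ∈ S, u ≠ v → H.Adj u v := by
  have hsub := edges_subset_image_offDiag H S E hE
  have heq := Finset.eq_of_subset_of_card_le hsub
    (by rwa [Sym2.card_image_offDiag, Finset.card_map])
  intro u hu v hv huv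
  have hmem : s(u, v) ∈ E.map (Function.Embedding.subtype _) := by
    rw [heq]
    exact Finset.mem_image.2 ⟨(u, v), Finset.mem_offDiag.2 ⟨hu, hv, huv⟩, rfl⟩
  obtain ⟨e, -, he⟩ := Finset.mem_map.1 hmem
  have := e.2
  rwa [show (e : Sym2 V) = s(u, v) from he] at this


/-- let `H` be a graph on `N` vertices `v_0,…,v_{N-1}` (0-indexed
here) and `h ≤ N` with `C(h,2) ≤ |F|`, where `F` is the edge set of `H`.
Consider the ESPC instance with clients `U ⊕ F`, two days, unit processing
times and `k = 1`, where on day 1 the precedence DAG has arcs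
`(v_ℓ, v_{ℓ+1})` for consecutive vertices and `(v_{N-1}, e)` for every edge
`e`, with deadline `N + |F| - C(h,2)`, and on day 2 the precedence DAG has an
arc `(v, e)` whenever `v ∈ e`, with deadline `h + C(h,2)`. Then `H` contains a
clique of size `h` iff this instance admits a 1-equitable pair of feasible
schedules (a schedule is a bijection of the clients to positions; the client
in position `σ c` is satisfied if `σ c + 1` is at most the deadline). -/
theorem clique_iff_espc_two_days (N h : ℕ) (hh : h ≤ N)
    (H : SimpleGraph (Fin N)) [DecidableRel H.Adj]
    (hF : Nat.choose h 2 ≤ Fintype.card ↥H.edgeSet) :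
    (∃ S : Finset (Fin N), S.card = h ∧
        ∀ u ∈ S, ∀ v ∈ S, u ≠ v → H.Adj u v)
      ↔
    (∃ σ₁ σ₂ : (Fin N ⊕ ↥H.edgeSet) ≃ Fin (Fintype.card (Fin N ⊕ ↥H.edgeSet)),
        -- day 1 precedence: a path through all vertex clients …
        (∀ a b : Fin N, (b : ℕ) = (a : ℕ) + 1 →
            σ₁ (Sum.inl a) < σ₁ (Sum.inl b)) ∧
        -- … followed by all edge clients after the last vertex client
        (∀ a : Fin N, (a : ℕ) = N - 1 →
            ∀ e : ↥H.edgeSet, σ₁ (Sum.inl a) < σ₁ (Sum.inr e)) ∧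
        -- day 2 precedence: each edge client after both its endpoints
        (∀ (v : Fin N) (e : ↥H.edgeSet), v ∈ (e : Sym2 (Fin N)) →
            σ₂ (Sum.inl v) < σ₂ (Sum.inr e)) ∧
        -- 1-equitability: every client meets the deadline on day 1 or day 2
        (∀ c : Fin N ⊕ ↥H.edgeSet,
            (σ₁ c : ℕ) + 1 ≤ N + Fintype.card ↥H.edgeSet - Nat.choose h 2 ∨
            (σ₂ c : ℕ) + 1 ≤ h + Nat.choose h 2)) := by
  classical
  constructor
  · rintro ⟨S, rfl, hS⟩
    have hC := card_edges_inside_clique H S hS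
    set E := Finset.univ.filter fun e : ↥H.edgeSet => ∀ v ∈ (e : Sym2 (Fin N)), v ∈ S with hE
    have hmemE : ∀ e : ↥H.edgeSet, e ∈ E ↔ ∀ v ∈ (e : Sym2 (Fin N)), v ∈ S := by simp [hE]
    let f₁ : Fin N ⊕ ↥H.edgeSet → ℕ :=
      Sum.elim (fun v => (v : ℕ)) (fun e => if e ∈ E then N + 1 else N)
    let f₂ : Fin N ⊕ ↥H.edgeSet → ℕ :=
      Sum.elim (fun v => if v ∈ S then 0 else 2) (fun e => if e ∈ E then 1 else 3)
    obtain ⟨σ₁, hσ₁⟩ := exists_equiv_fin_lt_of_rank_lt f₁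
    obtain ⟨σ₂, hσ₂⟩ := exists_equiv_fin_lt_of_rank_lt f₂
    have hday₁ : ∀ c, f₁ c ≤ N →
        (σ₁ c : ℕ) + 1 ≤ N + Fintype.card ↥H.edgeSet - Nat.choose S.card 2 := by
      intro c hc
      have := position_lt_of_rank_le f₁ σ₁ hσ₁ (Finset.univ.disjSum Eᶜ) c (by
        rintro (v | e) hle
        · simp
        · by_cases he : e ∈ E
          · simp only [f₁, Sum.elim_inr, if_pos he] at hle hc
            omega
          · simpa using he)
      rw [Finset.card_disjSum, Finset.card_compl, Finset.card_univ, Fintype.card_fin, hC] at this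
      omega
    refine ⟨σ₁, σ₂, ?_, ?_, ?_, ?_⟩
    · intro a b hab
      apply hσ₁
      simp only [f₁, Sum.elim_inl]
      omega
    · intro a _ e
      apply hσ₁
      simp only [f₁, Sum.elim_inl, Sum.elim_inr]
      split_ifs <;> omega
    · intro v e hv
      apply hσ₂
      simp only [f₂, Sum.elim_inl, Sum.elim_inr]
      by_cases he : e ∈ E
      · simp [he, (hmemE e).1 he v hv]
      · simp only [if_neg he]
        split_ifs <;> omega
    · rintro (v | e)
      · exact Or.inl (hday₁ _ (by simp [f₁, v.2.le]))
      · by_cases he : e ∈ E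
        · right
          rw [← hC, ← Finset.card_disjSum]
          refine position_lt_of_rank_le f₂ σ₂ hσ₂ _ _ ?_
          rintro (v | e') hle
          · by_cases hv : v ∈ S
            · simpa using hv
            · simp [f₂, he, hv] at hle
          · by_cases he' : e' ∈ E
            · simpa using he'
            · simp [f₂, he, he'] at hle
        · exact Or.inl (hday₁ _ (by simp [f₁, he]))
  · rintro ⟨σ₁, σ₂, hpath, hlast, hprec, hsat⟩
    rcases Nat.lt_or_ge h 2 with h2 | h2
    · obtain ⟨S, -, hS⟩ := Finset.exists_subset_card_eq
        (show h ≤ (Finset.univ : Finset (Fin N)).card by simpa using hh)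
      refine ⟨S, hS, fun u hu v hv huv => absurd ?_ huv⟩
      exact Finset.card_le_one.1 (by omega) u hu v hv
    have hbefore : ∀ (a : Fin N) (e : ↥H.edgeSet), σ₁ (Sum.inl a) < σ₁ (Sum.inr e) := by
      intro a e
      have key : ∀ k, ∀ b : Fin N, (b : ℕ) + k = N - 1 → σ₁ (Sum.inl b) < σ₁ (Sum.inr e) := by
        intro k
        induction k with
        | zero => exact fun b hb => hlast b hb e
        | succ k ih =>
          intro b hb
          exact (hpath b ⟨b + 1, by omega⟩ rfl).trans (ih _ (by simp only; omega))
      exact key (N - 1 - a) a (by omega)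
    have hvertex : ∀ a : Fin N,
        (σ₁ (Sum.inl a) : ℕ) + 1 ≤ N + Fintype.card ↥H.edgeSet - Nat.choose h 2 := by
      intro a
      have hsub : (Finset.univ : Finset ↥H.edgeSet).map
          (Function.Embedding.inr.trans σ₁.toEmbedding) ⊆ Finset.Ioi (σ₁ (Sum.inl a)) := by
        intro i hi
        obtain ⟨e, -, rfl⟩ := Finset.mem_map.1 hi
        exact Finset.mem_Ioi.2 (hbefore a e)
      have := Finset.card_le_card hsub
      have hlt := (σ₁ (Sum.inl a)).2
      rw [Finset.card_map, Finset.card_univ, Fin.card_Ioi] at this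
      have hn : Fintype.card (Fin N ⊕ ↥H.edgeSet) = N + Fintype.card ↥H.edgeSet := by
        rw [Fintype.card_sum, Fintype.card_fin]
      omega
    let E := Finset.univ.filter fun e : ↥H.edgeSet =>
      ¬ (σ₁ (Sum.inr e) : ℕ) + 1 ≤ N + Fintype.card ↥H.edgeSet - Nat.choose h 2
    let S := Finset.univ.filter fun v : Fin N =>
      (σ₂ (Sum.inl v) : ℕ) + 1 ≤ h + Nat.choose h 2
    have hEsat : ∀ e ∈ E, (σ₂ (Sum.inr e) : ℕ) + 1 ≤ h + Nat.choose h 2 := fun e he =>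
      (hsat (Sum.inr e)).resolve_left (Finset.mem_filter.1 he).2
    have hEcard : Nat.choose h 2 ≤ E.card := by
      have := card_le_of_position_lt σ₁ (Finset.univ.disjSum Eᶜ) _ (by
        rintro (v | e) hc
        · exact hvertex v
        · by_contra hlate
          exact Finset.mem_compl.1 (Finset.inr_mem_disjSum.1 hc)
            (Finset.mem_filter.2 ⟨Finset.mem_univ _, hlate⟩))
      rw [Finset.card_disjSum, Finset.card_compl, Finset.card_univ, Fintype.card_fin] at this
      have := Finset.card_le_univ E
      omega
    have hScard : S.card + E.card ≤ h + Nat.choose h 2 := by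
      rw [← Finset.card_disjSum]
      refine card_le_of_position_lt σ₂ _ _ ?_
      rintro (v | e) hc
      · simpa [S] using hc
      · exact hEsat e (by simpa using hc)
    have hES : ∀ e ∈ E, ∀ v ∈ (e : Sym2 (Fin N)), v ∈ S := by
      intro e he v hv
      have h₁ := hEsat e he
      have h₂ : (σ₂ (Sum.inl v) : ℕ) < σ₂ (Sum.inr e) := hprec v e hv
      exact Finset.mem_filter.2 ⟨Finset.mem_univ _, by omega⟩
    have hEle : E.card ≤ S.card.choose 2 := by
      have := Finset.card_le_card (edges_subset_image_offDiag H S E hES)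
      rwa [Sym2.card_image_offDiag, Finset.card_map] at this
    have hSh : S.card = h := by
      refine le_antisymm (by omega) (not_lt.1 fun hlt => ?_)
      have hmono : S.card.choose 2 ≤ (h - 1).choose 2 := Nat.choose_le_choose 2 (by omega)
      obtain ⟨k, rfl⟩ : ∃ k, h = k + 2 := ⟨h - 2, by omega⟩
      have hsucc : (k + 2).choose 2 = (k + 1) + (k + 1).choose 2 := by
        rw [Nat.choose_succ_succ', Nat.choose_one_right]
      rw [show k + 2 - 1 = k + 1 by omega] at hmono
      omega
    exact ⟨S, hSh, adj_of_choose_two_le_card_edges H S E hES (by rw [hSh]; exact hEcard)⟩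
end

section
/- Let s_1,…,s_N ∈ ℕ_{>0} be item sizes, let b ∈ ℕ_{>0} be a number of bins and B ∈ ℕ a bin capacity. Consider the ESPC instance whose client set is the disjoint union of paths: for each item i there are s_i clients c(i,1),…,c(i,s_i), the precedence DAG on every day consists of the arcs (c(i,ℓ), c(i,ℓ+1)) for all i and all ℓ ∈ {1,…,s_i−1}, there are m = b days, the deadline is d(j) = B on every day j, and k = 1. Then there exists a map f : {1,…,N} → {1,…,b} with Σ_{i : f(i) = j} s_i ≤ B for every bin j if and only if this ESPC instance admits a 1-equitable set of feasible schedules. -/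
/-- Any injective key into a linear order sorts a finite type. -/
theorem exists_equiv_fin_lt_iff_lt {α β : Type*} [Fintype α] [LinearOrder β] (g : α → β)
    (hg : Function.Injective g) :
    ∃ e : α ≃ Fin (Fintype.card α), ∀ a b, e a < e b ↔ g a < g b := by
  let _ : LinearOrder α := LinearOrder.lift' g hg
  let e := (Fintype.orderIsoFinOfCardEq α rfl).symm
  exact ⟨e.toEquiv, fun a b => e.lt_iff_lt⟩

theorem card_sigma_fin_filter_fst {N : ℕ} (s : Fin N → ℕ) (p : Fin N → Prop) [DecidablePred p] :
    (Finset.univ.filter (fun c : Σ i : Fin N, Fin (s i) => p c.1)).card =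
      ∑ i ∈ Finset.univ.filter p, s i := by
  have h : Finset.univ.filter (fun c : Σ i : Fin N, Fin (s i) => p c.1) =
      (Finset.univ.filter p).sigma (fun _ => Finset.univ) := by
    ext c
    simp
  rw [h, Finset.card_sigma]
  simp

/-- A set of elements that is downward closed for a numbering and contains `a` has more elements
than the number of `a`. -/
theorem Equiv.val_succ_le_card_of_forall_le_mem {α : Type*} {n : ℕ} (e : α ≃ Fin n)
    (S : Finset α) (a : α) (h : ∀ x, e x ≤ e a → x ∈ S) : (e a : ℕ) + 1 ≤ S.card := by
  rw [← Fin.card_Iic]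
  refine Finset.card_le_card_of_injOn e.symm (fun x hx => h _ ?_) e.symm.injective.injOn
  simpa using hx

/-- At most `B` elements have numbers below `B`. -/
theorem Equiv.card_le_of_forall_val_lt {α : Type*} {n B : ℕ} (e : α ≃ Fin n) (S : Finset α)
    (h : ∀ x ∈ S, (e x : ℕ) < B) : S.card ≤ B := by
  rw [← Finset.card_range B]
  exact Finset.card_le_card_of_injOn (fun x => (e x : ℕ)) (fun x hx => by simpa using h x hx)
    (Fin.val_injective.comp e.injective).injOn


/-- given item sizes `s i > 0` for `N` items, `b ≥ 1` bins of
capacity `B`, consider the ESPC instance whose clients are `c(i,ℓ)` for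
`i < N`, `ℓ < s i` (modelled as the sigma type `Σ i, Fin (s i)`), where on
every day the precedence DAG consists of the arcs `(c(i,ℓ), c(i,ℓ+1))`, there
are `m = b` days, the deadline is `B` on every day, and `k = 1`. Then the items
can be packed into the bins iff this instance admits a 1-equitable set of
feasible schedules (a schedule is a bijection of the clients to positions; the
client in position `σ c` is satisfied if `σ c + 1 ≤ B`). -/
theorem binPacking_iff_espc_paths (N b B : ℕ) (hb : 1 ≤ b)
    (s : Fin N → ℕ) (hs : ∀ i, 0 < s i) :
    (∃ f : Fin N → Fin b,
        ∀ j : Fin b, ∑ i ∈ Finset.univ.filter (fun i => f i = j), s i ≤ B)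
      ↔
    (∃ σ : Fin b →
        ((Σ i : Fin N, Fin (s i)) ≃ Fin (Fintype.card (Σ i : Fin N, Fin (s i)))),
        (∀ j : Fin b, ∀ i : Fin N, ∀ ℓ ℓ' : Fin (s i), (ℓ' : ℕ) = (ℓ : ℕ) + 1 →
            σ j ⟨i, ℓ⟩ < σ j ⟨i, ℓ'⟩) ∧
        (∀ c : Σ i : Fin N, Fin (s i),
            1 ≤ {j : Fin b | (σ j c : ℕ) + 1 ≤ B}.ncard)) := by
  constructor
  · rintro ⟨f, hf⟩
    let g : Fin b → (Σ i : Fin N, Fin (s i)) → ℕ ×ₗ ℕ ×ₗ ℕ := fun j c =>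
      toLex (if f c.1 = j then 0 else 1, toLex ((c.1 : ℕ), (c.2 : ℕ)))
    have hg : ∀ j, Function.Injective (g j) := by
      rintro j ⟨i, ℓ⟩ ⟨i', ℓ'⟩ h
      simp only [g, EmbeddingLike.apply_eq_iff_eq, Prod.mk.injEq] at h
      obtain ⟨-, hi, hl⟩ := h
      obtain rfl := Fin.ext hi
      obtain rfl := Fin.ext hl
      rfl
    choose σ hσ using fun j => exists_equiv_fin_lt_iff_lt (g j) (hg j)
    refine ⟨σ, fun j i ℓ ℓ' h => ?_, fun c => ?_⟩
    · rw [hσ]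
      simp [g, Prod.Lex.toLex_lt_toLex, h]
    · rw [Nat.one_le_iff_ne_zero, ← Nat.pos_iff_ne_zero, Set.ncard_pos]
      refine ⟨f c.1, le_trans ?_ (hf (f c.1))⟩
      rw [← card_sigma_fin_filter_fst s (fun i => f i = f c.1)]
      refine (σ (f c.1)).val_succ_le_card_of_forall_le_mem _ c fun x hx => ?_
      rw [Finset.mem_filter]
      refine ⟨Finset.mem_univ _, ?_⟩
      by_contra hne
      refine absurd hx (not_le.mpr ?_)
      rw [hσ]
      simp [g, Prod.Lex.toLex_lt_toLex, hne]
  · rintro ⟨σ, hprec, hsat⟩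
    have hday : ∀ i, ∃ j, ((σ j ⟨i, ⟨s i - 1, Nat.sub_lt (hs i) one_pos⟩⟩ : ℕ)) + 1 ≤ B :=
      fun i => Set.nonempty_of_ncard_ne_zero (Nat.one_le_iff_ne_zero.mp (hsat _))
    choose f hf using hday
    refine ⟨f, fun j => ?_⟩
    rw [← card_sigma_fin_filter_fst s (fun i => f i = j)]
    refine (σ j).card_le_of_forall_val_lt _ ?_
    rintro ⟨i, ℓ⟩ hc
    obtain rfl : f i = j := (Finset.mem_filter.mp hc).2
    have hmono : ∀ (d : ℕ) (ℓ ℓ' : Fin (s i)), (ℓ' : ℕ) = ℓ + d →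
        σ (f i) ⟨i, ℓ⟩ ≤ σ (f i) ⟨i, ℓ'⟩ := by
      intro d
      induction d with
      | zero =>
        intro ℓ ℓ' h
        obtain rfl : ℓ' = ℓ := Fin.ext h
        exact le_rfl
      | succ d ih =>
        intro ℓ ℓ' h
        have hlt : (ℓ : ℕ) + d < s i := by omega
        exact (ih ℓ ⟨ℓ + d, hlt⟩ rfl).trans (hprec (f i) i ⟨ℓ + d, hlt⟩ ℓ' h).le
    have hle := hmono (s i - 1 - ℓ) ℓ ⟨s i - 1, Nat.sub_lt (hs i) one_pos⟩
      (by have := ℓ.isLt; simp only; omega)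
    exact lt_of_le_of_lt hle (hf i)
end

section
/- Define recursively, for j ∈ {0,…,m} and ℓ : {1,…,n} → {0,…,k}, the predicate T(j,ℓ) by: T(j, 0) = true for every j (where 0 denotes the all-zero vector); T(0,ℓ) = false for ℓ ≠ 0; and for j ≥ 1 and ℓ ≠ 0, T(j,ℓ) = true if and only if there exists a set I* ⊆ {i : ℓ(i) ≥ 1} with Σ_{i ∈ I*} p(i,j) ≤ d(j) such that T(j−1, ℓ'), where ℓ'(i) = ℓ(i) − 1 for i ∈ I* and ℓ'(i) = ℓ(i) otherwise. Then T(m, (k,…,k)) = true if and only if the ESSD instance admits a k-equitable set of schedules. -/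
/-- The dynamic-programming table for ESSD (Theorem `thm:ESSDXP2`), with days
0-indexed: `essdDP2 n p d 0 ℓ` holds iff `ℓ = 0`; `essdDP2 n p d (j+1) ℓ` holds
iff `ℓ = 0`, or there is a set `I* ⊆ {i : ℓ i ≥ 1}` of clients whose total
processing time on (0-indexed) day `j` is at most the deadline `d j`, such that
`essdDP2 n p d j ℓ'` holds, where `ℓ' i = ℓ i - 1` for `i ∈ I*` and
`ℓ' i = ℓ i` otherwise. (Hence `T(j,0) = true` for every `j`, `T(0,ℓ) = false`
for `ℓ ≠ 0`, and for `j ≥ 1`, `ℓ ≠ 0` the recursion is as described.) -/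
def essdDP2 (n : ℕ) (p : Fin n → ℕ → ℕ) (d : ℕ → ℕ) :
    ℕ → (Fin n → ℕ) → Prop
  | 0, ℓ => ℓ = 0
  | j + 1, ℓ => ℓ = 0 ∨ ∃ I : Finset (Fin n),
      (∀ i ∈ I, 1 ≤ ℓ i) ∧ (∑ i ∈ I, p i j) ≤ d j ∧
      essdDP2 n p d j (fun i => if i ∈ I then ℓ i - 1 else ℓ i)

theorem essdDP2_iff_exists_sets (n : ℕ) (p : Fin n → ℕ → ℕ) (d : ℕ → ℕ) (j : ℕ)
    (ℓ : Fin n → ℕ) :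
    essdDP2 n p d j ℓ ↔ ∃ S : ℕ → Finset (Fin n),
      (∀ t < j, ∑ i ∈ S t, p i t ≤ d t) ∧
      ∀ i, ℓ i ≤ ∑ t ∈ Finset.range j, if i ∈ S t then 1 else 0 := by
  induction j generalizing ℓ with
  | zero =>
    simp [essdDP2, funext_iff]
  | succ j ih =>
    rw [essdDP2]
    constructor
    · rintro (rfl | ⟨I, -, hsum, hrec⟩)
      · exact ⟨fun _ => ∅, by simp, by simp⟩
      · obtain ⟨S, hS, hcount⟩ := (ih _).1 hrec
        refine ⟨Function.update S j I, fun t ht => ?_, fun i => ?_⟩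
        · rcases Nat.lt_succ_iff_lt_or_eq.1 ht with h | rfl
          · simpa [Function.update_of_ne h.ne] using hS t h
          · simpa using hsum
        · have hc := hcount i
          have heq : ∑ t ∈ Finset.range j, (if i ∈ Function.update S j I t then 1 else 0) =
              ∑ t ∈ Finset.range j, if i ∈ S t then 1 else 0 :=
            Finset.sum_congr rfl fun t ht => by
              rw [Function.update_of_ne (Finset.mem_range.1 ht).ne]
          rw [Finset.sum_range_succ, heq, Function.update_self]
          split_ifs at hc ⊢ <;> omega
    · rintro ⟨S, hS, hcount⟩
      refine Or.inr ⟨(S j).filter fun i => 1 ≤ ℓ i, fun i hi => (Finset.mem_filter.1 hi).2,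
        (Finset.sum_le_sum_of_subset (Finset.filter_subset _ _)).trans (hS j j.lt_succ_self),
        (ih _).2 ⟨S, fun t ht => hS t (ht.trans j.lt_succ_self), fun i => ?_⟩⟩
      have hc := hcount i
      rw [Finset.sum_range_succ] at hc
      simp only [Finset.mem_filter]
      split_ifs at hc ⊢ <;> grind

/-- Any set of clients can be scheduled before all the others. -/
theorem exists_perm_le_imp_mem {n : ℕ} (A : Finset (Fin n)) :
    ∃ σ : Equiv.Perm (Fin n), ∀ i ∈ A, ∀ i', σ i' ≤ σ i → i' ∈ A := by
  let f : Fin n → ℕ := fun i => if i ∈ A then 0 else 1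
  refine ⟨(Tuple.sort f).symm, fun i hi i' h => ?_⟩
  have hf := Tuple.monotone_sort f h
  simp only [Function.comp_apply, Equiv.apply_symm_apply] at hf
  by_contra hi'
  simp [f, hi, hi'] at hf

/-- The clients satisfied by a single schedule have total processing time at most the deadline. -/
theorem sum_satisfied_le {n : ℕ} (σ : Equiv.Perm (Fin n)) (q : Fin n → ℕ) (D : ℕ)
    (A : Finset (Fin n))
    (hA : ∀ i ∈ A, ∑ i' ∈ Finset.univ.filter (fun i' => σ i' ≤ σ i), q i' ≤ D) :
    ∑ i ∈ A, q i ≤ D := by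
  rcases A.eq_empty_or_nonempty with rfl | hne
  · simp
  · obtain ⟨i, hi, hmax⟩ := A.exists_max_image σ hne
    exact (Finset.sum_le_sum_of_subset fun i' hi' => by simpa using hmax i' hi').trans (hA i hi)

theorem ncard_setOf_fin_eq_sum_range (m : ℕ) (P : ℕ → Prop) [DecidablePred P] :
    {j : Fin m | P j}.ncard = ∑ t ∈ Finset.range m, if P t then 1 else 0 := by
  rw [← Fin.sum_univ_eq_sum_range (fun t => if P t then 1 else 0), ← Finset.card_filter,
    ← Set.ncard_coe_finset]
  simp

/-- `essdDP2 n p d m (k,…,k)` holds iff the ESSD instance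
(`n` clients with processing times `p i j > 0` on the `m` 0-indexed days,
common daily deadlines `d j`, equity parameter `k ≤ m`) admits a k-equitable
set of schedules. -/
theorem essdDP2_correct (n m k : ℕ) (hk : k ≤ m)
    (p : Fin n → ℕ → ℕ) (hp : ∀ i : Fin n, ∀ j < m, 0 < p i j) (d : ℕ → ℕ) :
    essdDP2 n p d m (fun _ => k) ↔
      ∃ σ : Fin m → Equiv.Perm (Fin n),
        ∀ i : Fin n, k ≤ {j : Fin m |
          ∑ i' ∈ Finset.univ.filter (fun i' => σ j i' ≤ σ j i),
            p i' (j : ℕ) ≤ d (j : ℕ)}.ncard := by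
  rw [essdDP2_iff_exists_sets]
  constructor
  · rintro ⟨S, hS, hcount⟩
    choose σ hσ using fun j : Fin m => exists_perm_le_imp_mem (S j)
    refine ⟨σ, fun i => ?_⟩
    refine (hcount i).trans ?_
    rw [← ncard_setOf_fin_eq_sum_range m (fun t => i ∈ S t)]
    refine Set.ncard_le_ncard (fun j hj => ?_) (Set.toFinite _)
    exact (Finset.sum_le_sum_of_subset fun i' hi' =>
      hσ j i hj i' (Finset.mem_filter.1 hi').2).trans (hS j j.2)
  · rintro ⟨σ, hσ⟩
    let S : ℕ → Finset (Fin n) := fun t => if h : t < m then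
      Finset.univ.filter fun i => ∑ i' ∈ Finset.univ.filter
        (fun i' => σ ⟨t, h⟩ i' ≤ σ ⟨t, h⟩ i), p i' t ≤ d t else ∅
    refine ⟨S, fun t ht => ?_, fun i => ?_⟩
    · refine sum_satisfied_le (σ ⟨t, ht⟩) (p · t) (d t) (S t) fun i hi => ?_
      simpa [S, ht] using hi
    · rw [← ncard_setOf_fin_eq_sum_range m (fun t => i ∈ S t)]
      simpa [S] using hσ i
end
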